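/- Let a, b ∈ ℤ and let T be a triangulation of the completed ∞-gon with a left fountain at a and a right fountain at b. Then there exist T-admissible sequences θ⁻ and θ⁺ such that the completed mutation μ̄_{θ⁻}(T) is a triangulation with a left fountain at a−1 and a right fountain at b, and the completed mutation μ̄_{θ⁺}(T) is a triangulation with a left fountain at a and a right fountain at b+1. -/

import Mathlib

open scoped Classical

/-- Vertices of the completed ∞-gon: `ℤ ∪ {−∞, +∞}` with the extended linear order. -/
abbrev Vtx : Type := WithBot (WithTop ℤ)

/-- The vertex corresponding to an integer. -/
def vInt (m : ℤ) : Vtx := ((m : WithTop ℤ) : Vtx)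

/-- The vertex `+∞`. -/
def vTop : Vtx := ((⊤ : WithTop ℤ) : Vtx)

/-- The vertex `−∞`. -/
def vBot : Vtx := (⊥ : Vtx)

/-- An arc of the completed ∞-gon: a pair of vertices `src < tgt` such that if both
endpoints are integers then they differ by at least `2`. -/
structure Arc where
  src : Vtx
  tgt : Vtx
  lt : src < tgt
  sep : ∀ m n : ℤ, src = vInt m → tgt = vInt n → m + 2 ≤ n

/-- Two arcs `(a,b)` and `(c,d)` cross if `a < c < b < d` or `c < a < d < b`. -/
def Cross (x y : Arc) : Prop :=
  (x.src < y.src ∧ y.src < x.tgt ∧ x.tgt < y.tgt) ∨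
  (y.src < x.src ∧ x.src < y.tgt ∧ y.tgt < x.tgt)

/-- A triangulation of the completed ∞-gon: a maximal set of pairwise compatible
(= non-crossing) arcs. -/
def IsTriangulation (T : Set Arc) : Prop :=
  (∀ x ∈ T, ∀ y ∈ T, ¬ Cross x y) ∧
  ∀ γ : Arc, (∀ x ∈ T, ¬ Cross γ x) → γ ∈ T

lemma vInt_lt_vTop (m : ℤ) : vInt m < vTop := by
  simpa [vInt, vTop] using WithBot.coe_lt_coe.mpr (WithTop.coe_lt_top (m : ℤ))

lemma vBot_lt_vInt (m : ℤ) : vBot < vInt m := WithBot.bot_lt_coe _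

lemma vBot_lt_vTop : vBot < vTop := WithBot.bot_lt_coe _

lemma vTop_ne_vInt (n : ℤ) : vTop ≠ vInt n := by simp [vTop, vInt]

lemma vBot_ne_vInt (n : ℤ) : vBot ≠ vInt n := by simp [vBot, vInt]

/-- The Prüfer curve `π_m = (m, +∞)`. -/
def prufer (m : ℤ) : Arc :=
  ⟨vInt m, vTop, vInt_lt_vTop m, fun _ n _ h => absurd h (vTop_ne_vInt n)⟩

/-- The adic curve `α_m = (−∞, m)`. -/
def adic (m : ℤ) : Arc :=
  ⟨vBot, vInt m, vBot_lt_vInt m, fun k _ h _ => absurd h (vBot_ne_vInt k)⟩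

/-- The generic curve `z = (−∞, +∞)`. -/
def generic : Arc :=
  ⟨vBot, vTop, vBot_lt_vTop, fun k _ h _ => absurd h (vBot_ne_vInt k)⟩

/-- `T` contains an arc with endpoints `x` and `y`. -/
def HasArc (T : Set Arc) (x y : Vtx) : Prop := ∃ γ ∈ T, γ.src = x ∧ γ.tgt = y

/-- `T` has a right fountain at the integer `n`. -/
def RightFountainInt (T : Set Arc) (n : ℤ) : Prop :=
  {p : ℤ | HasArc T (vInt n) (vInt p)}.Infinite

/-- `T` has a left fountain at the integer `n`. -/
def LeftFountainInt (T : Set Arc) (n : ℤ) : Prop :=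
  {p : ℤ | HasArc T (vInt p) (vInt n)}.Infinite

/-- `T` has a right fountain at the vertex `v`. -/
def RightFountain (T : Set Arc) (v : Vtx) : Prop :=
  (∃ n : ℤ, v = vInt n ∧ RightFountainInt T n) ∨
  (v = vTop ∧ {p : ℤ | 0 ≤ p ∧ prufer p ∈ T}.Infinite) ∨
  (v = vBot ∧ {p : ℤ | 0 ≤ p ∧ adic p ∈ T}.Infinite)

/-- `T` has a left fountain at the vertex `v`. -/
def LeftFountain (T : Set Arc) (v : Vtx) : Prop :=
  (∃ n : ℤ, v = vInt n ∧ LeftFountainInt T n) ∨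
  (v = vTop ∧ {p : ℤ | p ≤ 0 ∧ prufer p ∈ T}.Infinite) ∨
  (v = vBot ∧ {p : ℤ | p ≤ 0 ∧ adic p ∈ T}.Infinite)

/-- `T` is locally finite if every vertex is an endpoint of only finitely many arcs of `T`. -/
def LocallyFin (T : Set Arc) : Prop :=
  ∀ v : Vtx, {γ | γ ∈ T ∧ (γ.src = v ∨ γ.tgt = v)}.Finite

/-- An arc is peripheral if both endpoints are integers. -/
def IsPeripheral (γ : Arc) : Prop :=
  (∃ m : ℤ, γ.src = vInt m) ∧ ∃ n : ℤ, γ.tgt = vInt n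

/-- `γ'` is an exchange partner for `γ` relative to `T`:
it is distinct from `γ` and `(T \ {γ}) ∪ {γ'}` is again a triangulation. -/
def MutExchange (T : Set Arc) (γ γ' : Arc) : Prop :=
  γ' ≠ γ ∧ IsTriangulation ((T \ {γ}) ∪ {γ'})

/-- `γ` is a mutable arc of `T`. -/
def IsMutable (T : Set Arc) (γ : Arc) : Prop :=
  γ ∈ T ∧ ∃ γ', MutExchange T γ γ'

/-- The (unique) replacement arc of `γ` in `T`, when `γ` is mutable. -/
noncomputable def flipArc (T : Set Arc) (γ : Arc) : Arc :=
  if h : ∃ γ', MutExchange T γ γ' then h.choose else γ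

/-- The mutation `μ_γ(T)` of `T` at `γ`. -/
noncomputable def mutate (T : Set Arc) (γ : Arc) : Set Arc :=
  (T \ {γ}) ∪ {flipArc T γ}

/-- `μ_γ(δ)`: the effect of the mutation of `T` at `γ` on the arc `δ`. -/
noncomputable def mutArc (T : Set Arc) (γ δ : Arc) : Arc :=
  if δ = γ then flipArc T γ else δ

/-- One step of a mutation sequence on a set of arcs (`none` = no entry). -/
noncomputable def stepT (T : Set Arc) : Option Arc → Set Arc
  | none => T
  | some γ => mutate T γ

/-- One step of a mutation sequence on a single arc. -/
noncomputable def stepA (T : Set Arc) : Option Arc → Arc → Arc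
  | none, δ => δ
  | some γ, δ => mutArc T γ δ

/-- `iterT T θ k` is `μ_{θ_k} ∘ ⋯ ∘ μ_{θ_1}(T)`. Sequences (finite or infinite) are
encoded as `θ : ℕ → Option Arc` whose support is downward closed. -/
noncomputable def iterT (T : Set Arc) (θ : ℕ → Option Arc) : ℕ → Set Arc
  | 0 => T
  | k + 1 => stepT (iterT T θ k) (θ k)

/-- `iterA T θ γ k` is `μ_{θ_k} ∘ ⋯ ∘ μ_{θ_1}(γ)`. -/
noncomputable def iterA (T : Set Arc) (θ : ℕ → Option Arc) (γ : Arc) : ℕ → Arc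
  | 0 => γ
  | k + 1 => stepA (iterT T θ k) (θ k) (iterA T θ γ k)

/-- `θ` is a `T`-admissible sequence: its support is downward closed (so it is a genuine
finite or infinite sequence), each entry is mutable in the triangulation obtained by the
previous mutations, and the mutation of each arc of `T` along `θ` eventually stabilizes. -/
def Admissible (T : Set Arc) (θ : ℕ → Option Arc) : Prop :=
  (∀ i, θ i = none → θ (i + 1) = none) ∧
  (∀ i γ, θ i = some γ → IsMutable (iterT T θ i) γ) ∧
  (∀ γ ∈ T, ∃ l, ∀ k, l ≤ k → iterA T θ γ k = iterA T θ γ l)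

/-- `μ_θ(γ)`: the stable value of the mutation of the arc `γ` along the sequence `θ`. -/
noncomputable def seqLimit (T : Set Arc) (θ : ℕ → Option Arc) (γ : Arc) : Arc :=
  if h : ∃ l, ∀ k, l ≤ k → iterA T θ γ k = iterA T θ γ l
  then iterA T θ γ h.choose else γ

/-- `μ_θ(T)`: the mutation of `T` along the sequence `θ`. -/
noncomputable def mutSeq (T : Set Arc) (θ : ℕ → Option Arc) : Set Arc :=
  seqLimit T θ '' T

/-- The sequence `θ` leaves the arc `γ` untouched. -/
def Untouched (T : Set Arc) (θ : ℕ → Option Arc) (γ : Arc) : Prop :=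
  ∀ l, iterA T θ γ l = γ

/-- The quadrilateral `S(γ)` of a mutable arc `γ` in `T`: with `v₁ < v₂ < v₃ < v₄` the four
endpoints of the two diagonals `γ` and `flipArc T γ`, it consists of those of the pairs
`(v₁,v₂), (v₂,v₃), (v₃,v₄), (v₁,v₄)` that are arcs. -/
noncomputable def quad (T : Set Arc) (γ : Arc) : Set Arc :=
  let γ' := flipArc T γ
  let vs : Vtx × Vtx × Vtx × Vtx :=
    if γ.src < γ'.src then (γ.src, γ'.src, γ.tgt, γ'.tgt) else (γ'.src, γ.src, γ'.tgt, γ.tgt)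
  {δ : Arc | (δ.src = vs.1 ∧ δ.tgt = vs.2.1) ∨ (δ.src = vs.2.1 ∧ δ.tgt = vs.2.2.1) ∨
    (δ.src = vs.2.2.1 ∧ δ.tgt = vs.2.2.2) ∨ (δ.src = vs.1 ∧ δ.tgt = vs.2.2.2)}

/-- The set `𝒫` of Prüfer curves compatible with every arc of `S`. -/
def pruferCompletion (S : Set Arc) : Set Arc :=
  {γ | (∃ k : ℤ, γ = prufer k) ∧ ∀ x ∈ S, ¬ Cross γ x}

/-- The set `𝒜̃` of adic curves compatible with every arc of `S ∪ 𝒫(S)`. -/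
def adicCompletion' (S : Set Arc) : Set Arc :=
  {γ | (∃ k : ℤ, γ = adic k) ∧ ∀ x ∈ S ∪ pruferCompletion S, ¬ Cross γ x}

/-- The completed (Prüfer) mutation `μ̄_θ(T) = μ_θ(T) ∪ 𝒫 ∪ 𝒜̃` of `T` along `θ`. -/
noncomputable def completedMut (T : Set Arc) (θ : ℕ → Option Arc) : Set Arc :=
  mutSeq T θ ∪ pruferCompletion (mutSeq T θ) ∪ adicCompletion' (mutSeq T θ)

/-- The tower of triangulations associated to a composition of completed mutations. -/
noncomputable def compIter (T : Set Arc) (Θ : ℕ → Option (ℕ → Option Arc)) : ℕ → Set Arc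
  | 0 => T
  | k + 1 =>
    match Θ k with
    | none => compIter T Θ k
    | some θ => completedMut (compIter T Θ k) θ

/-- `Θ` is a `T`-admissible composition of completed mutations. -/
def CompAdmissible (T : Set Arc) (Θ : ℕ → Option (ℕ → Option Arc)) : Prop :=
  (∀ i, Θ i = none → Θ (i + 1) = none) ∧
  ∀ i θ, Θ i = some θ → Admissible (compIter T Θ i) θ

/-- The transfinite mutation of `T` along the composition `Θ`. -/
noncomputable def transfiniteMut (T : Set Arc) (Θ : ℕ → Option (ℕ → Option Arc)) : Set Arc :=
  ⋃ i, {γ ∈ compIter T Θ i |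
    ∀ k, i ≤ k → ∀ θ, Θ k = some θ → Untouched (compIter T Θ k) θ γ}

lemma vInt_lt (m n : ℤ) : vInt m < vInt n ↔ m < n := by
  simp [vInt]

lemma vInt_inj {m n : ℤ} : vInt m = vInt n ↔ m = n := by
  simp [vInt]

lemma vtx_cases (v : Vtx) : v = vBot ∨ v = vTop ∨ ∃ m, v = vInt m := by
  induction v using WithBot.recBotCoe with
  | bot => exact Or.inl rfl
  | coe v =>
    induction v using WithTop.recTopCoe with
    | top => exact Or.inr (Or.inl rfl)
    | coe m => exact Or.inr (Or.inr ⟨m, rfl⟩)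

lemma vInt_between {m n : ℤ} {d : Vtx} (h1 : vInt m < d) (h2 : d < vInt n) :
    ∃ k, d = vInt k ∧ m < k ∧ k < n := by
  rcases vtx_cases d with rfl | rfl | ⟨k, rfl⟩
  · exact absurd h1 (not_lt_of_gt (vBot_lt_vInt m))
  · exact absurd h2 (not_lt_of_gt (vInt_lt_vTop n))
  · exact ⟨k, rfl, (vInt_lt _ _).1 h1, (vInt_lt _ _).1 h2⟩

lemma Arc.ext' {x y : Arc} (h1 : x.src = y.src) (h2 : x.tgt = y.tgt) : x = y := by
  cases x; cases y; simp_all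

lemma Cross.symm' {x y : Arc} (h : Cross x y) : Cross y x := Or.symm h

/-- The peripheral arc with integer endpoints. -/
def pArc (m n : ℤ) (h : m + 2 ≤ n) : Arc :=
  ⟨vInt m, vInt n, (vInt_lt _ _).2 (by omega), fun k l hk hl => by
    rw [vInt_inj] at hk hl; omega⟩

/-- The arc `x` crosses the pair `(u,v)`. -/
def CrossV (x : Arc) (u v : Vtx) : Prop :=
  (x.src < u ∧ u < x.tgt ∧ x.tgt < v) ∨ (u < x.src ∧ x.src < v ∧ v < x.tgt)

/-- `(u,v)` is an arc in `U` or an edge. -/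
def Side (U : Set Arc) (u v : Vtx) : Prop :=
  (∃ δ ∈ U, δ.src = u ∧ δ.tgt = v) ∨ ∃ m : ℤ, u = vInt m ∧ v = vInt (m + 1)

lemma Side.not_crossV {U : Set Arc} {u v : Vtx} (h : Side U u v) {x : Arc}
    (hx : ∀ y ∈ U, ¬ Cross x y) : ¬ CrossV x u v := by
  rcases h with ⟨δ, hδ, rfl, rfl⟩ | ⟨m, rfl, rfl⟩
  · exact hx δ hδ
  · rintro (⟨_, h1, h2⟩ | ⟨h1, h2, _⟩) <;>
    · obtain ⟨k, _, h3, h4⟩ := vInt_between h1 h2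
      omega

lemma quad_order {V : Type*} [LinearOrder V] {v1 v2 v3 v4 c d : V} (h12 : v1 < v2) (h23 : v2 < v3)
    (h34 : v3 < v4) (hcd : c < d)
    (s12 : ¬ ((c < v1 ∧ v1 < d ∧ d < v2) ∨ (v1 < c ∧ c < v2 ∧ v2 < d)))
    (s23 : ¬ ((c < v2 ∧ v2 < d ∧ d < v3) ∨ (v2 < c ∧ c < v3 ∧ v3 < d)))
    (s34 : ¬ ((c < v3 ∧ v3 < d ∧ d < v4) ∨ (v3 < c ∧ c < v4 ∧ v4 < d)))
    (s14 : ¬ ((c < v1 ∧ v1 < d ∧ d < v4) ∨ (v1 < c ∧ c < v4 ∧ v4 < d))) :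
    (((c < v1 ∧ v1 < d ∧ d < v3) ∨ (v1 < c ∧ c < v3 ∧ v3 < d)) → c = v2 ∧ d = v4) ∧
    (((c < v2 ∧ v2 < d ∧ d < v4) ∨ (v2 < c ∧ c < v4 ∧ v4 < d)) → c = v1 ∧ d = v3) := by
  grind

lemma quad_cross {v1 v2 v3 v4 : Vtx} (h12 : v1 < v2) (h23 : v2 < v3) (h34 : v3 < v4)
    {U : Set Arc} (s12 : Side U v1 v2) (s23 : Side U v2 v3) (s34 : Side U v3 v4)
    (s14 : Side U v1 v4) {x : Arc} (hx : ∀ y ∈ U, ¬ Cross x y) :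
    (CrossV x v1 v3 → x.src = v2 ∧ x.tgt = v4) ∧
    (CrossV x v2 v4 → x.src = v1 ∧ x.tgt = v3) :=
  quad_order h12 h23 h34 x.lt (s12.not_crossV hx) (s23.not_crossV hx) (s34.not_crossV hx)
    (s14.not_crossV hx)

lemma flip_gen {T : Set Arc} (hT : IsTriangulation T) {γ γ' : Arc} (hγ : γ ∈ T)
    (hc : Cross γ γ')
    (h1 : ∀ x, (∀ y ∈ T \ {γ}, ¬ Cross x y) → Cross x γ → x = γ')
    (h2 : ∀ y ∈ T \ {γ}, ¬ Cross y γ') :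
    IsTriangulation ((T \ {γ}) ∪ {γ'}) ∧
    ∀ γ'', γ'' ≠ γ → IsTriangulation ((T \ {γ}) ∪ {γ''}) → γ'' = γ' := by
  refine ⟨⟨?_, ?_⟩, ?_⟩
  · rintro x (hx | rfl) y (hy | rfl)
    · exact hT.1 x hx.1 y hy.1
    · exact h2 x hx
    · exact fun h => h2 y hy h.symm'
    · rintro (h | h) <;> exact lt_irrefl _ h.1
  · intro δ hδ
    by_cases hδγ : Cross δ γ
    · exact Or.inr (h1 δ (fun y hy => hδ y (Or.inl hy)) hδγ)
    · refine Or.inl ⟨hT.2 δ fun x hx => ?_, ?_⟩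
      · by_cases hxγ : x = γ
        · rw [hxγ]; exact hδγ
        · exact hδ x (Or.inl ⟨hx, hxγ⟩)
      · rintro rfl
        exact hδ γ' (Or.inr rfl) hc
  · intro γ'' hne ht
    refine h1 γ'' (fun y hy => ht.1 _ (Or.inr rfl) _ (Or.inl hy)) ?_
    by_contra hcr
    have : γ ∈ (T \ {γ}) ∪ {γ''} := by
      refine ht.2 γ ?_
      rintro x (hx | rfl)
      · exact hT.1 γ hγ x hx.1
      · exact fun h => hcr h.symm'
    rcases this with h | h
    · exact h.2 rfl
    · exact hne h.symm

lemma flip_quad {T : Set Arc} (hT : IsTriangulation T) {γ γ' : Arc} (hγ : γ ∈ T)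
    {v1 v2 v3 v4 : Vtx} (h12 : v1 < v2) (h23 : v2 < v3) (h34 : v3 < v4)
    (s12 : Side (T \ {γ}) v1 v2) (s23 : Side (T \ {γ}) v2 v3) (s34 : Side (T \ {γ}) v3 v4)
    (s14 : Side (T \ {γ}) v1 v4)
    (hd : (γ.src = v1 ∧ γ.tgt = v3 ∧ γ'.src = v2 ∧ γ'.tgt = v4) ∨
      (γ.src = v2 ∧ γ.tgt = v4 ∧ γ'.src = v1 ∧ γ'.tgt = v3)) :
    IsTriangulation ((T \ {γ}) ∪ {γ'}) ∧
    ∀ γ'', γ'' ≠ γ → IsTriangulation ((T \ {γ}) ∪ {γ''}) → γ'' = γ' := by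
  have key := fun x (hx : ∀ y ∈ T \ {γ}, ¬ Cross x y) => quad_cross h12 h23 h34 s12 s23 s34 s14 hx
  rcases hd with ⟨rfl, rfl, rfl, rfl⟩ | ⟨rfl, rfl, rfl, rfl⟩
  · refine flip_gen hT hγ (Or.inl ⟨h12, h23, h34⟩) ?_ ?_
    · intro x hx hc
      obtain ⟨e1, e2⟩ := (key x hx).1 hc
      exact Arc.ext' e1 e2
    · intro y hy hc
      obtain ⟨e1, e2⟩ := (key y fun z hz => hT.1 y hy.1 z hz.1).2 hc
      exact hy.2 (Arc.ext' e1 e2)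
  · refine flip_gen hT hγ (Or.inr ⟨h12, h23, h34⟩) ?_ ?_
    · intro x hx hc
      obtain ⟨e1, e2⟩ := (key x hx).2 hc
      exact Arc.ext' e1 e2
    · intro y hy hc
      obtain ⟨e1, e2⟩ := (key y fun z hz => hT.1 y hy.1 z hz.1).1 hc
      exact hy.2 (Arc.ext' e1 e2)

/-- The intermediate triangulations. -/
def TT (T : Set Arc) (f g : ℕ → Arc) (k : ℕ) : Set Arc :=
  {x | (x ∈ T ∧ ∀ i < k, x ≠ f i) ∨ ∃ i < k, x = g i}

/-- The limit. -/
def SS (T : Set Arc) (f g : ℕ → Arc) : Set Arc :=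
  {x | (x ∈ T ∧ ∀ i, x ≠ f i) ∨ ∃ i, x = g i}

lemma TT_succ {T : Set Arc} {f g : ℕ → Arc} (hgf : ∀ i j, g i ≠ f j) (k : ℕ) :
    (TT T f g k \ {f k}) ∪ {g k} = TT T f g (k + 1) := by
  ext x
  simp only [TT, Set.mem_union, Set.mem_sdiff, Set.mem_ofPred_eq, Set.mem_singleton_iff]
  constructor
  · rintro (⟨⟨hx, h⟩ | ⟨i, hi, rfl⟩, hk⟩ | rfl)
    · refine Or.inl ⟨hx, fun i hi => ?_⟩
      rcases Nat.lt_succ_iff_lt_or_eq.1 hi with h' | rfl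
      · exact h i h'
      · exact hk
    · exact Or.inr ⟨i, by omega, rfl⟩
    · exact Or.inr ⟨k, by omega, rfl⟩
  · rintro (⟨hx, h⟩ | ⟨i, hi, rfl⟩)
    · exact Or.inl ⟨Or.inl ⟨hx, fun i hi => h i (by omega)⟩, h k (by omega)⟩
    · rcases Nat.lt_succ_iff_lt_or_eq.1 hi with h' | rfl
      · exact Or.inl ⟨Or.inr ⟨i, h', rfl⟩, hgf i k⟩
      · exact Or.inr rfl

lemma seqLimit_eq {T : Set Arc} {θ : ℕ → Option Arc} {γ δ : Arc} (l : ℕ)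
    (h : ∀ k, l ≤ k → iterA T θ γ k = δ) : seqLimit T θ γ = δ := by
  have hex : ∃ l, ∀ k, l ≤ k → iterA T θ γ k = iterA T θ γ l :=
    ⟨l, fun k hk => by rw [h k hk, h l le_rfl]⟩
  unfold seqLimit
  rw [dif_pos hex, ← hex.choose_spec (max l hex.choose) (le_max_right _ _)]
  exact h _ (le_max_left _ _)

lemma main_abs {T : Set Arc} (hT : IsTriangulation T) (f g : ℕ → Arc)
    (hf : ∀ i, f i ∈ T) (hfp : ∀ i, IsPeripheral (f i)) (finj : Function.Injective f)
    (hgf : ∀ i j, g i ≠ f j)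
    (hex : ∀ k, IsTriangulation (TT T f g k) →
      IsTriangulation ((TT T f g k \ {f k}) ∪ {g k}) ∧
      ∀ γ', γ' ≠ f k → IsTriangulation ((TT T f g k \ {f k}) ∪ {γ'}) → γ' = g k)
    (hev : ∀ γ, IsPeripheral γ → (∀ x ∈ SS T f g, ¬ Cross γ x) →
      ∃ K, ∀ i, K ≤ i → ¬ Cross γ (f i) ∧ γ ≠ f i) :
    ∃ θ, Admissible T θ ∧ IsTriangulation (completedMut T θ) ∧
      SS T f g ⊆ completedMut T θ := by
  have hTT : ∀ k, IsTriangulation (TT T f g k) := by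
    intro k
    induction k with
    | zero => simpa [TT] using hT
    | succ k ih => rw [← TT_succ hgf]; exact (hex k ih).1
  have hexch : ∀ k, MutExchange (TT T f g k) (f k) (g k) :=
    fun k => ⟨hgf k k, (hex k (hTT k)).1⟩
  have hflip : ∀ k, flipArc (TT T f g k) (f k) = g k := by
    intro k
    have h : ∃ γ', MutExchange (TT T f g k) (f k) γ' := ⟨_, hexch k⟩
    unfold flipArc
    rw [dif_pos h]
    exact (hex k (hTT k)).2 _ h.choose_spec.1 h.choose_spec.2
  let θ : ℕ → Option Arc := fun i => some (f i)
  have hit : ∀ k, iterT T θ k = TT T f g k := by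
    intro k
    induction k with
    | zero => simp [iterT, TT]
    | succ k ih =>
      show stepT (iterT T θ k) (some (f k)) = _
      rw [ih, ← TT_succ hgf]
      show mutate _ _ = _
      unfold mutate
      rw [hflip]
  have hstep : ∀ γ k, iterA T θ γ (k + 1) =
      if iterA T θ γ k = f k then g k else iterA T θ γ k := by
    intro γ k
    show stepA (iterT T θ k) (some (f k)) _ = _
    rw [hit]
    show mutArc _ _ _ = _
    unfold mutArc
    rw [hflip]
  have hA1 : ∀ γ, (∀ i, γ ≠ f i) → ∀ k, iterA T θ γ k = γ := by
    intro γ h k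
    induction k with
    | zero => rfl
    | succ k ih => rw [hstep, ih, if_neg (h k)]
  have hA2 : ∀ i k, iterA T θ (f i) k = if k ≤ i then f i else g i := by
    intro i k
    induction k with
    | zero => simp [iterA]
    | succ k ih =>
      rw [hstep, ih]
      rcases lt_trichotomy k i with h | rfl | h
      · rw [if_pos h.le, if_pos (show k + 1 ≤ i from h), if_neg]
        intro e
        exact h.ne' (finj e)
      · simp
      · rw [if_neg (show ¬ k ≤ i by omega), if_neg (show ¬ k + 1 ≤ i by omega), if_neg (hgf i k)]
  have hL1 : ∀ γ, (∀ i, γ ≠ f i) → seqLimit T θ γ = γ :=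
    fun γ h => seqLimit_eq 0 fun k _ => hA1 γ h k
  have hL2 : ∀ i, seqLimit T θ (f i) = g i :=
    fun i => seqLimit_eq (i + 1) fun k hk => by rw [hA2, if_neg (by omega)]
  have hS : mutSeq T θ = SS T f g := by
    ext x
    simp only [mutSeq, SS, Set.mem_image, Set.mem_ofPred_eq]
    constructor
    · rintro ⟨γ, hγ, rfl⟩
      by_cases h : ∀ i, γ ≠ f i
      · rw [hL1 γ h]; exact Or.inl ⟨hγ, h⟩
      · push Not at h
        obtain ⟨i, rfl⟩ := h
        exact Or.inr ⟨i, hL2 i⟩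
    · rintro (⟨hx, h⟩ | ⟨i, rfl⟩)
      · exact ⟨x, hx, hL1 x h⟩
      · exact ⟨f i, hf i, hL2 i⟩
  have hSTT : ∀ x ∈ SS T f g, ∃ K, ∀ k, K ≤ k → x ∈ TT T f g k := by
    rintro x (⟨hx, h⟩ | ⟨i, rfl⟩)
    · exact ⟨0, fun k _ => Or.inl ⟨hx, fun i _ => h i⟩⟩
    · exact ⟨i + 1, fun k hk => Or.inr ⟨i, by omega, rfl⟩⟩
  have hSnc : ∀ x ∈ SS T f g, ∀ y ∈ SS T f g, ¬ Cross x y := by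
    intro x hx y hy
    obtain ⟨K, hK⟩ := hSTT x hx
    obtain ⟨L, hL⟩ := hSTT y hy
    exact (hTT (max K L)).1 x (hK _ (le_max_left _ _)) y (hL _ (le_max_right _ _))
  refine ⟨θ, ⟨?_, ?_, ?_⟩, ⟨?_, ?_⟩, ?_⟩
  · intro i h
    exact absurd h (by simp [θ])
  · intro i γ h
    have : f i = γ := by simpa [θ] using h
    subst this
    rw [hit]
    refine ⟨Or.inl ⟨hf i, fun j hj e => ?_⟩, _, hexch i⟩
    have := finj e
    omega
  · intro γ hγ
    by_cases h : ∀ i, γ ≠ f i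
    · exact ⟨0, fun k _ => by rw [hA1 γ h, hA1 γ h]⟩
    · push Not at h
      obtain ⟨i, rfl⟩ := h
      exact ⟨i + 1, fun k hk => by rw [hA2, hA2, if_neg (by omega), if_neg (by omega)]⟩
  · unfold completedMut
    rw [hS]
    have hpp : ∀ k l, ¬ Cross (prufer k) (prufer l) := by
      rintro k l (h | h) <;> exact lt_irrefl _ h.2.2
    have haa : ∀ k l, ¬ Cross (adic k) (adic l) := by
      rintro k l (h | h) <;> exact lt_irrefl _ h.1
    rintro x ((hx | hx) | hx) y ((hy | hy) | hy) hc
    · exact hSnc x hx y hy hc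
    · exact hy.2 x hx hc.symm'
    · exact hy.2 x (Or.inl hx) hc.symm'
    · exact hx.2 y hy hc
    · obtain ⟨⟨k, rfl⟩, _⟩ := hx
      obtain ⟨⟨l, rfl⟩, _⟩ := hy
      exact hpp k l hc
    · exact hy.2 x (Or.inr hx) hc.symm'
    · exact hx.2 y (Or.inl hy) hc
    · exact hx.2 y (Or.inr hy) hc
    · obtain ⟨⟨k, rfl⟩, _⟩ := hx
      obtain ⟨⟨l, rfl⟩, _⟩ := hy
      exact haa k l hc
  · unfold completedMut
    rw [hS]
    intro γ hγ
    have hγS : ∀ x ∈ SS T f g, ¬ Cross γ x := fun x hx => hγ x (Or.inl (Or.inl hx))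
    have hper : IsPeripheral γ → γ ∈ SS T f g := by
      intro hp
      obtain ⟨K, hK⟩ := hev γ hp hγS
      have : γ ∈ TT T f g K := by
        refine (hTT K).2 γ ?_
        rintro x (⟨hx, h⟩ | ⟨i, hi, rfl⟩)
        · by_cases h' : ∀ i, x ≠ f i
          · exact hγS x (Or.inl ⟨hx, h'⟩)
          · push Not at h'
            obtain ⟨i, rfl⟩ := h'
            refine (hK i ?_).1
            by_contra hlt
            exact h i (by omega) rfl
        · exact hγS _ (Or.inr ⟨i, rfl⟩)
      rcases this with ⟨hx, h⟩ | ⟨i, hi, rfl⟩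
      · refine Or.inl ⟨hx, fun i => ?_⟩
        by_cases hi : i < K
        · exact h i hi
        · exact (hK i (by omega)).2
      · exact Or.inr ⟨i, rfl⟩
    -- the non-peripheral cases
    obtain ⟨c, d, hlt, hsep⟩ := γ
    rcases vtx_cases c with rfl | rfl | ⟨m, rfl⟩
    · rcases vtx_cases d with rfl | rfl | ⟨n, rfl⟩
      · exact absurd hlt (lt_irrefl _)
      · refine Or.inl (Or.inl (Or.inl ⟨hT.2 _ ?_, ?_⟩))
        · rintro x _ (⟨_, _, h⟩ | ⟨h, _, _⟩)
          · exact not_top_lt h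
          · exact not_lt_bot h
        · intro i e
          obtain ⟨⟨m, hm⟩, _⟩ := hfp i
          rw [← e] at hm
          exact vBot_ne_vInt m hm
      · refine Or.inr ⟨⟨n, rfl⟩, ?_⟩
        rintro x hx
        exact hγ x (Or.inl hx)
    · exact absurd hlt not_top_lt
    · rcases vtx_cases d with rfl | rfl | ⟨n, rfl⟩
      · exact absurd hlt not_lt_bot
      · exact Or.inl (Or.inr ⟨⟨m, rfl⟩, hγS⟩)
      · exact Or.inl (Or.inl (hper ⟨⟨m, rfl⟩, ⟨n, rfl⟩⟩))
  · unfold completedMut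
    rw [hS]
    exact fun x hx => Or.inl (Or.inl hx)

lemma exists_enum (P : ℕ → Prop) (hP : {n | P n}.Infinite) (h0 : P 0) :
    ∃ q : ℕ → ℕ, StrictMono q ∧ q 0 = 0 ∧ (∀ i, P (q i)) ∧ ∀ n, P n → ∃ i, q i = n := by
  refine ⟨Nat.nth P, Nat.nth_strictMono hP, Nat.nth_zero_of_zero h0,
    fun i => Nat.nth_mem_of_infinite hP i, fun n hn => ?_⟩
  have : n ∈ Set.range (Nat.nth P) := by
    rw [Nat.range_nth_of_infinite hP]; exact hn
  exact this

lemma pArc_mem {T : Set Arc} {m n : ℤ} (h : HasArc T (vInt m) (vInt n)) :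
    ∃ h : m + 2 ≤ n, pArc m n h ∈ T := by
  obtain ⟨γ, hγ, h1, h2⟩ := h
  have hs := γ.sep m n h1 h2
  refine ⟨hs, ?_⟩
  have : pArc m n hs = γ := Arc.ext' h1.symm h2.symm
  rwa [this]

lemma right_move {T : Set Arc} (hT : IsTriangulation T) {b : ℤ} (hb : RightFountainInt T b) :
    ∃ θ, Admissible T θ ∧ IsTriangulation (completedMut T θ) ∧
      RightFountainInt (completedMut T θ) (b + 1) ∧
      ∀ x ∈ T, x.src ≠ vInt b → x ∈ completedMut T θ := by
  have hinf : {n : ℕ | n = 0 ∨ HasArc T (vInt b) (vInt (b + 1 + n))}.Infinite := by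
    intro hfin
    refine hb ((hfin.image (fun n : ℕ => b + 1 + (n : ℤ))).subset ?_)
    intro m hm
    obtain ⟨h, _⟩ := pArc_mem hm
    refine ⟨(m - b - 1).toNat, Or.inr ?_, by simp only; omega⟩
    have : b + 1 + (((m - b - 1).toNat : ℕ) : ℤ) = m := by omega
    rw [this]; exact hm
  obtain ⟨r, rmono, r0, rP, rsurj⟩ := exists_enum _ hinf (Or.inl rfl)
  obtain ⟨q, hq⟩ : ∃ q : ℕ → ℤ, ∀ i, q i = b + 1 + r i := ⟨_, fun _ => rfl⟩
  have q0 : q 0 = b + 1 := by rw [hq, r0]; simp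
  have qmono : StrictMono q := fun i j h => by
    have := rmono h; rw [hq, hq]; omega
  have qge : ∀ i : ℕ, b + 1 + (i : ℤ) ≤ q i := fun i => by
    have := rmono.id_le i
    simp only [id] at this
    rw [hq]; omega
  have hs1 : ∀ i, b + 2 ≤ q (i + 1) := fun i => by have := qge (i + 1); omega
  have hs2 : ∀ i, b + 1 + 2 ≤ q (i + 2) := fun i => by have := qge (i + 2); omega
  have hfT : ∀ i, pArc b (q (i + 1)) (hs1 i) ∈ T := by
    intro i
    have : HasArc T (vInt b) (vInt (q (i + 1))) := by
      rcases rP (i + 1) with h | h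
      · have := rmono (Nat.succ_pos i); simp only [Nat.succ_eq_add_one] at this; omega
      · rw [hq]; exact h
    exact (pArc_mem this).2
  have hsurj : ∀ m, HasArc T (vInt b) (vInt m) → ∃ i, m = q i := by
    intro m hm
    obtain ⟨h, _⟩ := pArc_mem hm
    have e : b + 1 + (((m - b - 1).toNat : ℕ) : ℤ) = m := by omega
    obtain ⟨i, hi⟩ := rsurj (m - b - 1).toNat (Or.inr (by rw [e]; exact hm))
    exact ⟨i, by rw [hq, hi]; omega⟩
  have hside : ∀ i, q (i + 1) = q i + 1 ∨ ∃ h, pArc (q i) (q (i + 1)) h ∈ T := by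
    intro i
    by_cases h : q (i + 1) = q i + 1
    · exact Or.inl h
    have hlt := qmono (Nat.lt_succ_self i)
    simp only [Nat.succ_eq_add_one] at hlt
    have hbq : b < q i := by have := qge i; omega
    refine Or.inr ⟨by omega, hT.2 _ ?_⟩
    intro x hx hc
    have hxf := hT.1 x hx _ (hfT i)
    rcases hc with ⟨h1, h2, h3⟩ | ⟨h1, h2, h3⟩
    · simp only [pArc] at h1 h2 h3
      exact hxf (Or.inr ⟨lt_trans ((vInt_lt _ _).2 hbq) h1, h2, h3⟩)
    · simp only [pArc] at h1 h2 h3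
      rcases lt_trichotomy x.src (vInt b) with hc | hc | hc
      · exact hxf (Or.inl ⟨hc, lt_trans ((vInt_lt _ _).2 hbq) h2, h3⟩)
      · obtain ⟨m, hm, h4, h5⟩ := vInt_between h2 h3
        obtain ⟨j, rfl⟩ := hsurj m ⟨x, hx, hc, hm⟩
        have := qmono.lt_iff_lt.1 h4
        have := qmono.lt_iff_lt.1 h5
        omega
      · obtain ⟨m, hm, h4, h5⟩ := vInt_between hc h1
        rcases i with _ | i
        · omega
        · exact hT.1 x hx _ (hfT i) (Or.inr ⟨hc, h1, h2⟩)
  have hpb : prufer b ∈ T := by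
    refine hT.2 _ ?_
    rintro x hx (⟨_, _, h⟩ | ⟨h1, h2, h3⟩)
    · exact not_top_lt h
    · simp only [prufer] at h1 h2 h3
      rcases vtx_cases x.tgt with h | h | ⟨m, h⟩
      · rw [h] at h2; exact not_lt_bot h2
      · rw [h] at h3; exact lt_irrefl _ h3
      · refine hT.1 x hx _ (hfT (m - b).toNat) (Or.inl ⟨h1, h2, ?_⟩)
        rw [h]
        refine (vInt_lt _ _).2 ?_
        have := qge ((m - b).toNat + 1)
        omega
  obtain ⟨f, hf⟩ : ∃ f : ℕ → Arc, f = fun i => pArc b (q (i + 1)) (hs1 i) := ⟨_, rfl⟩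
  obtain ⟨g, hg⟩ : ∃ g : ℕ → Arc, g = fun i => pArc (b + 1) (q (i + 2)) (hs2 i) := ⟨_, rfl⟩
  have fs : ∀ i, (f i).src = vInt b := fun i => by rw [hf]; rfl
  have ft : ∀ i, (f i).tgt = vInt (q (i + 1)) := fun i => by rw [hf]; rfl
  have gs : ∀ i, (g i).src = vInt (b + 1) := fun i => by rw [hg]; rfl
  have gt : ∀ i, (g i).tgt = vInt (q (i + 2)) := fun i => by rw [hg]; rfl
  have hfT' : ∀ i, f i ∈ T := fun i => by rw [hf]; exact hfT i
  have finj : Function.Injective f := by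
    intro i j h
    have h' := congrArg Arc.tgt h
    rw [ft, ft, vInt_inj] at h'
    have := qmono.injective h'
    omega
  have hne : ∀ x : Arc, x.src ≠ vInt b → ∀ i, x ≠ f i := by
    rintro x hx i rfl
    exact hx (fs i)
  have hgf : ∀ i j, g i ≠ f j := fun i j => hne _ (by rw [gs, Ne, vInt_inj]; omega) j
  have hsideU : ∀ i k, Side (TT T f g k \ {f k}) (vInt (q i)) (vInt (q (i + 1))) := by
    intro i k
    rcases hside i with h | ⟨h, hm⟩
    · exact Or.inr ⟨q i, rfl, by rw [h]⟩
    · have : ∀ j, pArc (q i) (q (i + 1)) h ≠ f j := hne _ (by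
        have := qge i
        simp only [pArc, Ne, vInt_inj]; omega)
      exact Or.inl ⟨_, ⟨Or.inl ⟨hm, fun j _ => this j⟩, this k⟩, rfl, rfl⟩
  obtain ⟨θ, h1, h2, h3⟩ := main_abs hT f g hfT' (fun i => ⟨⟨_, fs i⟩, ⟨_, ft i⟩⟩) finj hgf
    (by
      intro k hk
      refine flip_quad hk (v1 := vInt b) (v2 := vInt (b + 1)) (v3 := vInt (q (k + 1)))
        (v4 := vInt (q (k + 2))) ?_ ?_ ?_ ?_ ?_ ?_ ?_ ?_ (Or.inl ⟨fs k, ft k, gs k, gt k⟩)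
      · exact Or.inl ⟨hfT' k, fun i hi e => absurd (finj e) (by omega)⟩
      · exact (vInt_lt _ _).2 (by omega)
      · exact (vInt_lt _ _).2 (by have := hs1 k; omega)
      · exact (vInt_lt _ _).2 (qmono (by omega))
      · exact Or.inr ⟨b, rfl, rfl⟩
      · rcases k with _ | k
        · have := hsideU 0 0
          rwa [q0] at this
        · exact Or.inl ⟨g k, ⟨Or.inr ⟨k, by omega, rfl⟩, hgf _ _⟩, gs k, gt k⟩
      · exact hsideU (k + 1) k
      · exact Or.inl ⟨f (k + 1), ⟨Or.inl ⟨hfT' _, fun i hi e => absurd (finj e) (by omega)⟩,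
          fun e => absurd (finj e) (by omega)⟩, fs _, ft _⟩)
    (by
      rintro γ ⟨⟨c, hc⟩, ⟨d, hd⟩⟩ hS
      refine ⟨(d - b).toNat, fun i hi => ?_⟩
      have hq' : d < q (i + 1) := by have := qge (i + 1); omega
      refine ⟨?_, ?_⟩
      · rintro (⟨h1, h2, h3⟩ | ⟨h1, h2, h3⟩)
        · refine hS (prufer b) (Or.inl ⟨hpb, fun j e => ?_⟩) (Or.inl ⟨?_, ?_, ?_⟩)
          · have := ft j
            rw [← e] at this
            exact vTop_ne_vInt _ this
          · rw [fs] at h1; exact h1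
          · rw [fs] at h2; exact h2
          · rw [hd]; exact vInt_lt_vTop d
        · rw [ft, hd, vInt_lt] at h3
          omega
      · rintro rfl
        rw [ft, vInt_inj] at hd
        omega)
  refine ⟨θ, h1, h2, ?_, ?_⟩
  · refine Set.infinite_of_injective_forall_mem (f := fun i : ℕ => q (i + 2)) ?_ ?_
    · intro i j h
      have := qmono.injective h
      omega
    · intro i
      exact ⟨g i, h3 (Or.inr ⟨i, rfl⟩), gs i, gt i⟩
  · exact fun x hx hxs => h3 (Or.inl ⟨hx, hne x hxs⟩)

lemma left_move {T : Set Arc} (hT : IsTriangulation T) {a : ℤ} (ha : LeftFountainInt T a) :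
    ∃ θ, Admissible T θ ∧ IsTriangulation (completedMut T θ) ∧
      LeftFountainInt (completedMut T θ) (a - 1) ∧
      ∀ x ∈ T, x.tgt ≠ vInt a → x ∈ completedMut T θ := by
  have hinf : {n : ℕ | n = 0 ∨ HasArc T (vInt (a - 1 - n)) (vInt a)}.Infinite := by
    intro hfin
    refine ha ((hfin.image (fun n : ℕ => a - 1 - (n : ℤ))).subset ?_)
    intro m hm
    obtain ⟨h, _⟩ := pArc_mem hm
    refine ⟨(a - 1 - m).toNat, Or.inr ?_, by simp only; omega⟩
    have : a - 1 - (((a - 1 - m).toNat : ℕ) : ℤ) = m := by omega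
    rw [this]; exact hm
  obtain ⟨r, rmono, r0, rP, rsurj⟩ := exists_enum _ hinf (Or.inl rfl)
  obtain ⟨q, hq⟩ : ∃ q : ℕ → ℤ, ∀ i, q i = a - 1 - r i := ⟨_, fun _ => rfl⟩
  have q0 : q 0 = a - 1 := by rw [hq, r0]; simp
  have qmono : StrictAnti q := fun i j h => by
    have := rmono h; rw [hq, hq]; omega
  have qge : ∀ i, q i ≤ a - 1 - (i : ℤ) := fun i => by
    have := rmono.id_le i
    simp only [id] at this
    rw [hq]; omega
  have hs1 : ∀ i, q (i + 1) + 2 ≤ a := fun i => by have := qge (i + 1); omega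
  have hs2 : ∀ i, q (i + 2) + 2 ≤ a - 1 := fun i => by have := qge (i + 2); omega
  have hfT : ∀ i, pArc (q (i + 1)) a (hs1 i) ∈ T := by
    intro i
    have : HasArc T (vInt (q (i + 1))) (vInt a) := by
      rcases rP (i + 1) with h | h
      · have := rmono (Nat.succ_pos i); simp only [Nat.succ_eq_add_one] at this; omega
      · rw [hq]; exact h
    exact (pArc_mem this).2
  have hsurj : ∀ m, HasArc T (vInt m) (vInt a) → ∃ i, m = q i := by
    intro m hm
    obtain ⟨h, _⟩ := pArc_mem hm
    have e : a - 1 - (((a - 1 - m).toNat : ℕ) : ℤ) = m := by omega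
    obtain ⟨i, hi⟩ := rsurj (a - 1 - m).toNat (Or.inr (by rw [e]; exact hm))
    exact ⟨i, by rw [hq, hi]; omega⟩
  have hside : ∀ i, q i = q (i + 1) + 1 ∨ ∃ h, pArc (q (i + 1)) (q i) h ∈ T := by
    intro i
    by_cases h : q i = q (i + 1) + 1
    · exact Or.inl h
    have hlt := qmono (Nat.lt_succ_self i)
    simp only [Nat.succ_eq_add_one] at hlt
    have hbq : q i < a := by have := qge i; omega
    refine Or.inr ⟨by omega, hT.2 _ ?_⟩
    intro x hx hc
    have hxf := hT.1 x hx _ (hfT i)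
    rcases hc with ⟨h1, h2, h3⟩ | ⟨h1, h2, h3⟩
    · simp only [pArc] at h1 h2 h3
      rcases lt_trichotomy x.tgt (vInt a) with hc | hc | hc
      · obtain ⟨m, hm, h4, h5⟩ := vInt_between h3 hc
        rcases i with _ | i
        · omega
        · exact hT.1 x hx _ (hfT i) (Or.inl ⟨h2, h3, hc⟩)
      · obtain ⟨m, hm, h4, h5⟩ := vInt_between h1 h2
        obtain ⟨j, rfl⟩ := hsurj m ⟨x, hx, hm, hc⟩
        have := qmono.lt_iff_gt.1 h4
        have := qmono.lt_iff_gt.1 h5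
        omega
      · exact hxf (Or.inr ⟨h1, lt_trans h2 ((vInt_lt _ _).2 hbq), hc⟩)
    · simp only [pArc] at h1 h2 h3
      exact hxf (Or.inl ⟨h1, h2, lt_trans h3 ((vInt_lt _ _).2 hbq)⟩)
  have hpb : adic a ∈ T := by
    refine hT.2 _ ?_
    rintro x hx (⟨h1, h2, h3⟩ | ⟨h, _, _⟩)
    · simp only [adic] at h1 h2 h3
      rcases vtx_cases x.src with h | h | ⟨m, h⟩
      · rw [h] at h1; exact lt_irrefl _ h1
      · rw [h] at h2; exact not_top_lt h2
      · refine hT.1 x hx _ (hfT (a - m).toNat) (Or.inr ⟨?_, h2, h3⟩)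
        rw [h]
        refine (vInt_lt _ _).2 ?_
        have := qge ((a - m).toNat + 1)
        omega
    · exact not_lt_bot h
  obtain ⟨f, hf⟩ : ∃ f : ℕ → Arc, f = fun i => pArc (q (i + 1)) a (hs1 i) := ⟨_, rfl⟩
  obtain ⟨g, hg⟩ : ∃ g : ℕ → Arc, g = fun i => pArc (q (i + 2)) (a - 1) (hs2 i) := ⟨_, rfl⟩
  have fs : ∀ i, (f i).src = vInt (q (i + 1)) := fun i => by rw [hf]; rfl
  have ft : ∀ i, (f i).tgt = vInt a := fun i => by rw [hf]; rfl
  have gs : ∀ i, (g i).src = vInt (q (i + 2)) := fun i => by rw [hg]; rfl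
  have gt : ∀ i, (g i).tgt = vInt (a - 1) := fun i => by rw [hg]; rfl
  have hfT' : ∀ i, f i ∈ T := fun i => by rw [hf]; exact hfT i
  have finj : Function.Injective f := by
    intro i j h
    have h' := congrArg Arc.src h
    rw [fs, fs, vInt_inj] at h'
    have := qmono.injective h'
    omega
  have hne : ∀ x : Arc, x.tgt ≠ vInt a → ∀ i, x ≠ f i := by
    rintro x hx i rfl
    exact hx (ft i)
  have hgf : ∀ i j, g i ≠ f j := fun i j => hne _ (by rw [gt, Ne, vInt_inj]; omega) j
  have hsideU : ∀ i k, Side (TT T f g k \ {f k}) (vInt (q (i + 1))) (vInt (q i)) := by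
    intro i k
    rcases hside i with h | ⟨h, hm⟩
    · exact Or.inr ⟨q (i + 1), rfl, by rw [h]⟩
    · have : ∀ j, pArc (q (i + 1)) (q i) h ≠ f j := hne _ (by
        have := qge i
        simp only [pArc, Ne, vInt_inj]; omega)
      exact Or.inl ⟨_, ⟨Or.inl ⟨hm, fun j _ => this j⟩, this k⟩, rfl, rfl⟩
  obtain ⟨θ, h1, h2, h3⟩ := main_abs hT f g hfT' (fun i => ⟨⟨_, fs i⟩, ⟨_, ft i⟩⟩) finj hgf
    (by
      intro k hk
      refine flip_quad hk (v1 := vInt (q (k + 2))) (v2 := vInt (q (k + 1)))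
        (v3 := vInt (a - 1)) (v4 := vInt a) ?_ ?_ ?_ ?_ ?_ ?_ ?_ ?_
        (Or.inr ⟨fs k, ft k, gs k, gt k⟩)
      · exact Or.inl ⟨hfT' k, fun i hi e => absurd (finj e) (by omega)⟩
      · exact (vInt_lt _ _).2 (qmono (by omega))
      · exact (vInt_lt _ _).2 (by have := hs1 k; omega)
      · exact (vInt_lt _ _).2 (by omega)
      · exact hsideU (k + 1) k
      · rcases k with _ | k
        · have := hsideU 0 0
          rwa [q0] at this
        · exact Or.inl ⟨g k, ⟨Or.inr ⟨k, by omega, rfl⟩, hgf _ _⟩, gs k, gt k⟩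
      · exact Or.inr ⟨a - 1, rfl, by rw [sub_add_cancel]⟩
      · exact Or.inl ⟨f (k + 1), ⟨Or.inl ⟨hfT' _, fun i hi e => absurd (finj e) (by omega)⟩,
          fun e => absurd (finj e) (by omega)⟩, fs _, ft _⟩)
    (by
      rintro γ ⟨⟨c, hc⟩, ⟨d, hd⟩⟩ hS
      refine ⟨(a - c).toNat, fun i hi => ?_⟩
      have hq' : q (i + 1) < c := by have := qge (i + 1); omega
      refine ⟨?_, ?_⟩
      · rintro (⟨h1, h2, h3⟩ | ⟨h1, h2, h3⟩)
        · rw [fs, hc, vInt_lt] at h1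
          omega
        · refine hS (adic a) (Or.inl ⟨hpb, fun j e => ?_⟩) (Or.inr ⟨?_, ?_, ?_⟩)
          · have := fs j
            rw [← e] at this
            exact vBot_ne_vInt _ this
          · rw [hc]; exact vBot_lt_vInt c
          · rw [ft] at h2; exact h2
          · rw [ft] at h3; exact h3
      · rintro rfl
        rw [fs, vInt_inj] at hc
        omega)
  refine ⟨θ, h1, h2, ?_, ?_⟩
  · refine Set.infinite_of_injective_forall_mem (f := fun i : ℕ => q (i + 2)) ?_ ?_
    · intro i j h
      have := qmono.injective h
      omega
    · intro i
      exact ⟨g i, h3 (Or.inr ⟨i, rfl⟩), gs i, gt i⟩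
  · exact fun x hx hxs => h3 (Or.inl ⟨hx, hne x hxs⟩)

lemma fountain_le {T : Set Arc} (hT : IsTriangulation T) {a b : ℤ}
    (ha : LeftFountainInt T a) (hb : RightFountainInt T b) : a ≤ b := by
  by_contra hlt
  push Not at hlt
  have h1 : ∃ p < b, HasArc T (vInt p) (vInt a) := by
    by_contra hcon
    push Not at hcon
    refine ha ((Set.finite_Icc b a).subset fun p hp => ?_)
    obtain ⟨h, _⟩ := pArc_mem hp
    refine ⟨?_, by omega⟩
    by_contra hpb
    exact hcon p (by omega) hp
  have h2 : ∃ p > a, HasArc T (vInt b) (vInt p) := by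
    by_contra hcon
    push Not at hcon
    refine hb ((Set.finite_Icc b a).subset fun p hp => ?_)
    obtain ⟨h, _⟩ := pArc_mem hp
    refine ⟨by omega, ?_⟩
    by_contra hpb
    exact hcon p (by omega) hp
  obtain ⟨p, hp, hpa⟩ := h1
  obtain ⟨r, hr, hra⟩ := h2
  obtain ⟨_, m1⟩ := pArc_mem hpa
  obtain ⟨_, m2⟩ := pArc_mem hra
  exact hT.1 _ m1 _ m2 (Or.inl ⟨(vInt_lt _ _).2 hp, (vInt_lt _ _).2 hlt, (vInt_lt _ _).2 hr⟩)

/-- Moving fountains: if `T` has a left fountain at `a ∈ ℤ` and a right fountain at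
`b ∈ ℤ`, then there are `T`-admissible sequences whose completed mutations are
triangulations with a left fountain at `a−1` and a right fountain at `b`, respectively with
a left fountain at `a` and a right fountain at `b+1`. -/
theorem statement18 (a b : ℤ) (T : Set Arc) (hT : IsTriangulation T)
    (ha : LeftFountainInt T a) (hb : RightFountainInt T b) :
    (∃ θm : ℕ → Option Arc, Admissible T θm ∧
        IsTriangulation (completedMut T θm) ∧
        LeftFountainInt (completedMut T θm) (a - 1) ∧
        RightFountainInt (completedMut T θm) b) ∧
    (∃ θp : ℕ → Option Arc, Admissible T θp ∧
        IsTriangulation (completedMut T θp) ∧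
        LeftFountainInt (completedMut T θp) a ∧
        RightFountainInt (completedMut T θp) (b + 1)) := by
  have hab := fountain_le hT ha hb
  constructor
  · obtain ⟨θ, h1, h2, h3, h4⟩ := left_move hT ha
    refine ⟨θ, h1, h2, h3, hb.mono ?_⟩
    rintro p ⟨γ, hγ, e1, e2⟩
    have := γ.sep _ _ e1 e2
    refine ⟨γ, h4 γ hγ ?_, e1, e2⟩
    rw [e2, Ne, vInt_inj]
    omega
  · obtain ⟨θ, h1, h2, h3, h4⟩ := right_move hT hb
    refine ⟨θ, h1, h2, ha.mono ?_, h3⟩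
    rintro p ⟨γ, hγ, e1, e2⟩
    have := γ.sep _ _ e1 e2
    refine ⟨γ, h4 γ hγ ?_, e1, e2⟩
    rw [e1, Ne, vInt_inj]
    omega
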